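/- For every integer d ≥ 3 and every μ ∈ [0,1], one has ψ(p*, d, μ, 1-μ, 0) ≤ α_alg. -/

import Mathlib

noncomputable def g (p : ℝ) (d : ℕ) : ℝ :=
  1 + (1 - (1 - p) / (d : ℝ)) ^ d + ((1 - p) * (1 - 1 / (d : ℝ))) ^ d

noncomputable def pstar : ℝ := (10 - 6 * Real.sqrt 2) / 7

noncomputable def alphaAlg : ℝ := g pstar 3

noncomputable def zeta (p : ℝ) (d : ℕ) (μA μB μC : ℝ) : ℝ :=
  let T : ℝ := 1 - μA + μA * (1 - (1 - p) / (d : ℝ)) ^ d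
  let E : ℝ := 1 - μB + Real.exp (p - 1) * μB
  let Q : ℝ := (1 - p) ^ d * (1 - μA + μA * (1 - 1 / (d : ℝ)) ^ d)
  1 + T / 2 + E * T / 2 + μC * (1 - p) * E * T + (1 - μC * (1 - p)) * E * Q

noncomputable def psi (p : ℝ) (d : ℕ) (μA μB μC : ℝ) : ℝ :=
  zeta p d μA μB μC / (μA + 1.5 * μB + 3 * μC)

/-- An affine criterion for the bound on `psi`: both sides are compared at `μ = 1` and to first
order in `1 - μ`, the remaining quadratic term being nonpositive. The parameters `t`, `e`, `q`, `r`
may be any upper bounds for the quantities that occur in `zeta`. -/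
theorem psi_le_of_upper_bounds {p t e q r α μ : ℝ} {d : ℕ} (hμ : μ ∈ Set.Icc (0 : ℝ) 1)
    (ht₀ : 0 ≤ (1 - (1 - p) / (d : ℝ)) ^ d) (ht : (1 - (1 - p) / (d : ℝ)) ^ d ≤ t) (ht₁ : t ≤ 1)
    (he : Real.exp (p - 1) ≤ e) (he₁ : e ≤ 1)
    (hq₀ : 0 ≤ (1 - p) ^ d) (hq : (1 - p) ^ d ≤ q)
    (hr₀ : 0 ≤ (1 - 1 / (d : ℝ)) ^ d) (hr : (1 - 1 / (d : ℝ)) ^ d ≤ r) (hr₁ : r ≤ 1)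
    (h_one : 1 + t + q * r ≤ α)
    (h_slope : (1 - t) - t * (1 - e) / 2 + q * (1 - r) - q * r * (1 - e) ≤ α / 2) :
    psi p d μ (1 - μ) 0 ≤ α := by
  obtain ⟨h0, h1⟩ := hμ
  have hexp := Real.exp_pos (p - 1)
  have hb : 0 ≤ 1 - μ := sub_nonneg.2 h1
  unfold psi zeta
  rw [div_le_iff₀ (by linarith)]
  dsimp only
  generalize (1 - (1 - p) / (d : ℝ)) ^ d = t₀ at *
  generalize Real.exp (p - 1) = e₀ at *
  generalize (1 - p) ^ d = q₀ at *
  generalize (1 - 1 / (d : ℝ)) ^ d = r₀ at *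
  have hT₀ : 0 ≤ 1 - μ + μ * t₀ := by positivity
  have hT : 1 - μ + μ * t₀ ≤ 1 - μ + μ * t := by gcongr
  have hE₀ : 0 ≤ 1 - (1 - μ) + e₀ * (1 - μ) := by
    have : 0 ≤ e₀ * (1 - μ) := by positivity
    linarith
  have hE : 1 - (1 - μ) + e₀ * (1 - μ) ≤ 1 - (1 - μ) + e * (1 - μ) := by gcongr
  have hQ₀ : 0 ≤ q₀ * (1 - μ + μ * r₀) := by positivity
  have hQ : q₀ * (1 - μ + μ * r₀) ≤ q * (1 - μ + μ * r) := by gcongr; linarith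
  have hET := mul_le_mul hE hT hT₀ (hE₀.trans hE)
  have hEQ := mul_le_mul hE hQ hQ₀ (hE₀.trans hE)
  have h_slope_mul := mul_le_mul_of_nonneg_left h_slope hb
  have h_quad : 0 ≤ (1 - μ) ^ 2 * ((1 - e) * ((1 - t) / 2 + q * (1 - r))) := by
    have := sub_nonneg.2 he₁
    have := sub_nonneg.2 ht₁
    have := sub_nonneg.2 hr₁
    have := hq₀.trans hq
    positivity
  linear_combination hT / 2 + hET / 2 + hEQ + h_one + h_slope_mul + h_quad

theorem one_sub_pstar_mem_Icc : 1 - pstar ∈ Set.Icc (0.7836 : ℝ) 0.78362 := by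
  have h₁ : (1.41421 : ℝ) ≤ √2 := Real.le_sqrt_of_sq_le (by norm_num)
  have h₂ : √2 ≤ (1.41422 : ℝ) := Real.sqrt_le_iff.2 (by norm_num)
  unfold pstar
  constructor <;> linarith

theorem exp_pstar_sub_one_le : Real.exp (pstar - 1) ≤ 0.458 := by
  have hs := one_sub_pstar_mem_Icc.1
  have h : (2.186 : ℝ) ≤ Real.exp 0.7836 :=
    le_trans (by norm_num [Finset.sum_range_succ, Nat.factorial])
      (Real.sum_le_exp_of_nonneg (by norm_num) 5)
  calc Real.exp (pstar - 1) ≤ Real.exp (-0.7836) := Real.exp_le_exp.2 (by linarith)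
    _ = (Real.exp 0.7836)⁻¹ := Real.exp_neg _
    _ ≤ (2.186 : ℝ)⁻¹ := by gcongr
    _ ≤ 0.458 := by norm_num

theorem le_alphaAlg : 1.5457 ≤ alphaAlg := by
  obtain ⟨h₁, h₂⟩ := one_sub_pstar_mem_Icc
  unfold alphaAlg g
  push_cast
  have ht : (1 - 0.78362 / 3 : ℝ) ^ 3 ≤ (1 - (1 - pstar) / 3) ^ 3 := by gcongr
  have hq : (0.7836 * (1 - 1 / 3) : ℝ) ^ 3 ≤ ((1 - pstar) * (1 - 1 / 3)) ^ 3 := by gcongr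
  norm_num at ht hq ⊢
  linarith

theorem psi_le_alphaAlg_d_ge_three (d : ℕ) (hd : 3 ≤ d) :
    ∀ μ ∈ Set.Icc (0 : ℝ) 1, psi pstar d μ (1 - μ) 0 ≤ alphaAlg := by
  intro μ hμ
  obtain ⟨hs₁, hs₂⟩ := one_sub_pstar_mem_Icc
  have hα := le_alphaAlg
  have he := exp_pstar_sub_one_le
  have hs₀ : 0 ≤ 1 - pstar := by linarith
  have hd' : (3 : ℝ) ≤ d := by exact_mod_cast hd
  have ht₀ : 0 ≤ 1 - (1 - pstar) / (d : ℝ) :=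
    sub_nonneg.2 ((div_le_one (by linarith)).2 (by linarith))
  have hr₀ : 0 ≤ 1 - 1 / (d : ℝ) := sub_nonneg.2 ((div_le_one (by linarith)).2 (by linarith))
  have bound {t q r : ℝ} (ht : (1 - (1 - pstar) / (d : ℝ)) ^ d ≤ t) (ht₁ : t ≤ 1)
      (hq : (1 - pstar) ^ d ≤ q) (hr : (1 - 1 / (d : ℝ)) ^ d ≤ r) (hr₁ : r ≤ 1) :=
    psi_le_of_upper_bounds (α := alphaAlg) hμ (pow_nonneg ht₀ d) ht ht₁ he (by norm_num)
      (pow_nonneg hs₀ d) hq (pow_nonneg hr₀ d) hr hr₁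
  obtain rfl | rfl | rfl | hd6 : d = 3 ∨ d = 4 ∨ d = 5 ∨ 6 ≤ d := by lia
  · have ht : (1 - 0.78362 / 3 : ℝ) ^ 3 ≤ (1 - (1 - pstar) / 3) ^ 3 := by gcongr
    have hq : (1 - pstar) ^ 3 ≤ (0.78362 : ℝ) ^ 3 := by gcongr
    refine bound le_rfl (pow_le_one₀ ht₀ ?_) le_rfl le_rfl (by norm_num) ?_ ?_
    · push_cast; linarith
    · rw [← mul_pow]; rfl
    · norm_num at ht hq ⊢
      linarith
  · have ht : (1 - (1 - pstar) / 4) ^ 4 ≤ (1 - 0.7836 / 4 : ℝ) ^ 4 := by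
      push_cast at ht₀; gcongr
    have hq : (1 - pstar) ^ 4 ≤ (0.78362 : ℝ) ^ 4 := by gcongr
    refine bound (t := 0.4181) (q := 0.378) (r := 0.3165) ?_ ?_ ?_ ?_ ?_ ?_ ?_ <;>
      norm_num at ht hq ⊢ <;> linarith
  · have ht : (1 - (1 - pstar) / 5) ^ 5 ≤ (1 - 0.7836 / 5 : ℝ) ^ 5 := by
      push_cast at ht₀; gcongr
    have hq : (1 - pstar) ^ 5 ≤ (0.78362 : ℝ) ^ 5 := by gcongr
    refine bound (t := 0.4265) (q := 0.2956) (r := 0.3277) ?_ ?_ ?_ ?_ ?_ ?_ ?_ <;>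
      norm_num at ht hq ⊢ <;> linarith
  · have ht : (1 - (1 - pstar) / (d : ℝ)) ^ d ≤ 0.458 := by
      refine (Real.one_sub_div_pow_le_exp_neg (by linarith)).trans ?_
      rwa [neg_sub]
    have hr : (1 - 1 / (d : ℝ)) ^ d ≤ 0.3679 :=
      (Real.one_sub_div_pow_le_exp_neg (by linarith)).trans
        (by linarith [Real.exp_neg_one_lt_d9])
    have hq : (1 - pstar) ^ d ≤ 0.2316 :=
      calc (1 - pstar) ^ d ≤ (1 - pstar) ^ 6 := pow_le_pow_of_le_one hs₀ (by linarith) hd6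
        _ ≤ (0.78362 : ℝ) ^ 6 := by gcongr
        _ ≤ 0.2316 := by norm_num
    exact bound ht (by norm_num) hq hr (by norm_num) (by linarith) (by linarith)
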